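/- Let i, j be orthogonal imaginary units and let f be a slice regular function on D⁴ that is continuous on the closed unit ball of ℍ, with ℂ(i)-components f₁, f₂ on D_i and with the ℂ(i)-components f₁′ = (f′ − i f′ i)/2 and f₂′ (where f₂′·j = (f′ + i f′ i)/2) of its slice derivative. For x ∈ D_i and k = 1, 2 set M_{k,x} = sup{‖f_k(y)‖ : y ∈ D_i, ‖y − x‖ ≤ 1 − ‖x‖}. Then for every x ∈ D_i: (1/4)·(1 − ‖x‖)²·‖f′(x)‖² + ‖f(x)‖² ≤ (‖x‖ − 1)·(‖f₁′(x)‖·‖f₁(x)‖ + ‖f₂′(x)‖·‖f₂(x)‖) + M_{1,x}² + M_{2,x}². -/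

import Mathlib

noncomputable section

notation "ℍ" => Quaternion ℝ

def IsImaginaryUnit (i : ℍ) : Prop := i.re = 0 ∧ ‖i‖ = 1

def OrthogonalUnits (i j : ℍ) : Prop :=
  IsImaginaryUnit i ∧ IsImaginaryUnit j ∧ (i * star j).re = 0

def qslice (i : ℍ) : Set ℍ := {z | ∃ x y : ℝ, z = (x : ℍ) + y • i}

def sliceDisc (i : ℍ) : Set ℍ := {z ∈ qslice i | ‖z‖ < 1}

def sliceCircle (i : ℍ) : Set ℍ := {z ∈ qslice i | ‖z‖ = 1}

def unitBall : Set ℍ := {q : ℍ | ‖q‖ < 1}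

structure IsMajorant (ω : ℝ → ℝ) : Prop where
  contOn : ContinuousOn ω (Set.Icc 0 2)
  map_zero : ω 0 = 0
  nonneg : ∀ t ∈ Set.Icc (0:ℝ) 2, 0 ≤ ω t
  mono : MonotoneOn ω (Set.Icc 0 2)
  div_anti : AntitoneOn (fun t => ω t / t) (Set.Ioc 0 2)

def IsRegularMajorant (ω : ℝ → ℝ) : Prop :=
  IsMajorant ω ∧ ∃ C > 0, ∀ x : ℝ, 0 < x → x < 2 →
    (∫ t in (0:ℝ)..x, ω t / t) + x * (∫ t in x..(2:ℝ), ω t / t ^ 2) ≤ C * ω x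

def SliceRegularOn (f : ℍ → ℍ) (a : ℕ → ℍ) : Prop :=
  (∀ r : ℝ, 0 ≤ r → r < 1 → Summable (fun n => ‖a n‖ * r ^ n)) ∧
  (∀ q ∈ unitBall, HasSum (fun n => q ^ n * a n) (f q))

def IsSliceRegular (f : ℍ → ℍ) : Prop := ∃ a : ℕ → ℍ, SliceRegularOn f a

def SliceDeriv (f f' : ℍ → ℍ) (a : ℕ → ℍ) : Prop :=
  SliceRegularOn f a ∧
  (∀ q ∈ unitBall, HasSum (fun n => ((n + 1 : ℕ) : ℝ) • (q ^ n * a (n + 1))) (f' q))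

def expI (i : ℍ) (t : ℝ) : ℍ := (Real.cos t : ℍ) + Real.sin t • i

def poisson (i : ℍ) (u : ℍ → ℝ) (q : ℍ) : ℝ :=
  (1 / (2 * Real.pi)) * ∫ t in (0:ℝ)..(2 * Real.pi),
    u (expI i t) * (1 - ‖q‖ ^ 2) / ‖q - expI i t‖ ^ 2

def comp1 (i : ℍ) (f : ℍ → ℍ) : ℍ → ℍ := fun q => (2⁻¹ : ℝ) • (f q - i * f q * i)

def comp2 (i j : ℍ) (f : ℍ → ℍ) : ℍ → ℍ := fun q => ((2⁻¹ : ℝ) • (f q + i * f q * i)) * j⁻¹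

lemma disc_aux {g : ℂ → ℂ} {c : ℂ} {R M : ℝ} (hR : 0 < R)
    (hd : DifferentiableOn ℂ g (Metric.ball c R))
    (hM : ∀ z ∈ Metric.ball c R, ‖g z‖ ≤ M) :
    R / 2 * ‖deriv g c‖ + ‖g c‖ ≤ M := by
  refine le_of_forall_gt_imp_ge_of_dense fun N hN => ?_
  have hc : c ∈ Metric.ball c R := Metric.mem_ball_self hR
  have hg0 : ‖g c‖ < N := (hM c hc).trans_lt hN
  have hN0 : 0 < N := (norm_nonneg _).trans_lt hg0
  set s := (starRingEnd ℂ) (g c) with hs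
  have hsn : ‖s‖ = ‖g c‖ := by simp [hs]
  have hden : ∀ z ∈ Metric.ball c R, (N : ℂ) ^ 2 - s * g z ≠ 0 := by
    intro z hz h0
    have h1 : (N : ℂ) ^ 2 = s * g z := sub_eq_zero.mp h0
    have h2 : N ^ 2 = ‖g c‖ * ‖g z‖ := by
      have := congrArg norm h1
      simpa [hsn, abs_of_pos hN0] using this
    have h3 := (hM z hz).trans_lt hN
    nlinarith [norm_nonneg (g z), norm_nonneg (g c)]
  set h : ℂ → ℂ := fun z => (g z - g c) / ((N : ℂ) ^ 2 - s * g z) with hh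
  have hhd : DifferentiableOn ℂ h (Metric.ball c R) :=
    (hd.sub_const _).div ((differentiableOn_const _).sub (hd.const_mul s)) hden
  have hhc : h c = 0 := by simp [hh]
  have hmaps : Set.MapsTo h (Metric.ball c R) (Metric.closedBall (h c) (1 / N)) := by
    intro z hz
    rw [hhc, mem_closedBall_zero_iff]
    simp only [hh]
    rw [norm_div, div_le_div_iff₀ (norm_pos_iff.mpr (hden z hz)) hN0, one_mul]
    have h3 := (hM z hz).trans_lt hN
    have ha : 0 ≤ (N ^ 2 - ‖g z‖ ^ 2) * (N ^ 2 - ‖g c‖ ^ 2) := by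
      apply mul_nonneg <;> nlinarith [norm_nonneg (g z), norm_nonneg (g c)]
    refine le_of_sq_le_sq ?_ (norm_nonneg _)
    rw [mul_pow]
    simp only [Complex.sq_norm, Complex.normSq_apply, hs] at ha ⊢
    simp [pow_two] at ha ⊢
    nlinarith [ha]
  have hb := Complex.norm_deriv_le_div_of_mapsTo_ball hhd hmaps hR
  have hga : HasDerivAt g (deriv g c) c :=
    (hd.differentiableAt (Metric.ball_mem_nhds c hR)).hasDerivAt
  have hder : deriv h c = deriv g c / ((N : ℂ) ^ 2 - s * g c) := by
    have := ((hga.sub_const (g c)).div ((hga.const_mul s).const_sub ((N : ℂ) ^ 2)) (hden c hc)).deriv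
    have h2 := hden c hc
    rw [show h = (fun z => g z - g c) / (fun z => (N : ℂ) ^ 2 - s * g z) from rfl, this]
    field_simp
    ring
  have hsg : (N : ℂ) ^ 2 - s * g c = ((N ^ 2 - ‖g c‖ ^ 2 : ℝ) : ℂ) := by
    rw [hs, mul_comm, Complex.mul_conj, Complex.normSq_eq_norm_sq]; push_cast; ring
  have hpos : 0 < N ^ 2 - ‖g c‖ ^ 2 := by nlinarith [norm_nonneg (g c)]
  rw [hder, hsg, norm_div, Complex.norm_real, Real.norm_of_nonneg hpos.le, div_div,
    div_le_div_iff₀ hpos (by positivity), one_mul] at hb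
  by_contra hcon
  push Not at hcon
  nlinarith [sq_nonneg (N - ‖g c‖)]

lemma ps_aux {β : ℕ → ℂ} {G : ℂ → ℂ}
    (hs : ∀ r : ℝ, 0 ≤ r → r < 1 → Summable (fun n => ‖β n‖ * r ^ n))
    (hG : ∀ z : ℂ, ‖z‖ < 1 → HasSum (fun n => z ^ n * β n) (G z)) :
    ∀ c : ℂ, ‖c‖ < 1 → DifferentiableAt ℂ G c ∧
      ∀ d, HasSum (fun n : ℕ => ((n : ℂ) + 1) * (c ^ n * β (n + 1))) d → deriv G c = d := by
  intro c hc
  obtain ⟨r, hr1, hr2⟩ := exists_between hc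
  have hr0 : 0 ≤ r := (norm_nonneg _).trans hr1.le
  have hcb : c ∈ Metric.ball (0 : ℂ) r := by simpa using hr1
  have hle : ∀ (n : ℕ) (w : ℂ), w ∈ Metric.ball (0 : ℂ) r → ‖w ^ n * β n‖ ≤ ‖β n‖ * r ^ n := by
    intro n w hw
    rw [mem_ball_zero_iff] at hw
    rw [norm_mul, norm_pow, mul_comm]
    gcongr
  have hfd : ∀ n : ℕ, DifferentiableOn ℂ (fun w : ℂ => w ^ n * β n) (Metric.ball (0 : ℂ) r) :=
    fun n => by fun_prop
  have hev : G =ᶠ[nhds c] fun w => ∑' n, w ^ n * β n := by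
    filter_upwards [Metric.isOpen_ball.mem_nhds hcb] with w hw
    rw [mem_ball_zero_iff] at hw
    exact (hG w (hw.trans hr2)).tsum_eq.symm
  have h1 := Complex.differentiableOn_tsum_of_summable_norm (hs r hr0 hr2) hfd
    Metric.isOpen_ball hle
  have h2 := Complex.hasSum_deriv_of_summable_norm (hs r hr0 hr2) hfd
    Metric.isOpen_ball hle hcb
  refine ⟨(h1.differentiableAt (Metric.isOpen_ball.mem_nhds hcb)).congr_of_eventuallyEq hev, ?_⟩
  intro d hd
  rw [hev.deriv_eq]
  refine h2.unique ?_
  rw [← hasSum_nat_add_iff' 1]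
  simp
  simpa only [mul_assoc] using hd

def phi (i : ℍ) (z : ℂ) : ℍ := (z.re : ℍ) + z.im • i

def prP (i : ℍ) : ℍ →ₗ[ℝ] ℂ where
  toFun q := ⟨q.re, i.imI * q.imI + i.imJ * q.imJ + i.imK * q.imK⟩
  map_add' x y := by apply Complex.ext <;> simp; ring
  map_smul' c x := by apply Complex.ext <;> simp; ring

lemma unit_sq {i : ℍ} (hi : IsImaginaryUnit i) :
    i.re = 0 ∧ i.imI ^ 2 + i.imJ ^ 2 + i.imK ^ 2 = 1 := by
  refine ⟨hi.1, ?_⟩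
  have h := Quaternion.normSq_eq_norm_mul_self i
  rw [hi.2, Quaternion.normSq_def', hi.1] at h
  linarith

lemma norm_phi {i : ℍ} (hi : IsImaginaryUnit i) (z : ℂ) : ‖phi i z‖ = ‖z‖ := by
  obtain ⟨h0, h1⟩ := unit_sq hi
  have : ‖phi i z‖ ^ 2 = ‖z‖ ^ 2 := by
    rw [Complex.sq_norm, Complex.normSq_apply, pow_two, ← Quaternion.normSq_eq_norm_mul_self,
      Quaternion.normSq_def']
    simp [phi, h0]
    linear_combination z.im ^ 2 * h1
  exact (sq_eq_sq₀ (norm_nonneg _) (norm_nonneg _)).mp this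

lemma phi_sub (i : ℍ) (z w : ℂ) : phi i (z - w) = phi i z - phi i w := by
  ext <;> simp [phi] <;> ring

lemma phi_mul {i : ℍ} (hi : IsImaginaryUnit i) (z w : ℂ) : phi i (z * w) = phi i z * phi i w := by
  obtain ⟨h0, h1⟩ := unit_sq hi
  ext <;> simp [phi, h0]
  · linear_combination z.im * w.im * h1
  all_goals ring

lemma phi_pow {i : ℍ} (hi : IsImaginaryUnit i) (z : ℂ) (n : ℕ) : phi i z ^ n = phi i (z ^ n) := by
  induction n with
  | zero => ext <;> simp [phi]
  | succ n ih => rw [pow_succ, ih, pow_succ, phi_mul hi]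

lemma prP_phi {i : ℍ} (hi : IsImaginaryUnit i) (z : ℂ) (q : ℍ) :
    prP i (phi i z * q) = z * prP i q := by
  obtain ⟨h0, h1⟩ := unit_sq hi
  apply Complex.ext <;> simp [prP, phi, h0]
  · ring
  · linear_combination z.im * q.re * h1

lemma comp1_eq {i : ℍ} (hi : IsImaginaryUnit i) (f : ℍ → ℍ) (q : ℍ) :
    comp1 i f q = phi i (prP i (f q)) := by
  obtain ⟨h0, h1⟩ := unit_sq hi
  ext <;> simp [prP, phi, comp1, h0]
  · linear_combination (1/2) * (f q).re * h1
  · linear_combination - (1/2) * (f q).imI * h1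
  · linear_combination - (1/2) * (f q).imJ * h1
  · linear_combination - (1/2) * (f q).imK * h1

lemma norm_prP {i : ℍ} (hi : IsImaginaryUnit i) (q : ℍ) : ‖prP i q‖ ≤ ‖q‖ := by
  have h := comp1_eq hi id q
  rw [← norm_phi hi, show q = id q from rfl, ← h]
  simp only [comp1, id]
  rw [norm_smul]
  have := norm_sub_le q (i * q * i)
  rw [norm_mul, norm_mul, hi.2] at this
  norm_num
  linarith

lemma key {i : ℍ} (hi : IsImaginaryUnit i) (f f' : ℍ → ℍ) (a : ℕ → ℍ)
    (hf : SliceDeriv f f' a) (hcont : ContinuousOn f (Metric.closedBall 0 1))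
    (x : ℍ) (hx : x ∈ sliceDisc i) :
    (1 - ‖x‖) / 2 * ‖comp1 i f' x‖ + ‖comp1 i f x‖ ≤
      sSup {r : ℝ | ∃ y ∈ sliceDisc i, ‖y - x‖ ≤ 1 - ‖x‖ ∧ r = ‖comp1 i f y‖} := by
  obtain ⟨⟨u, v, hxuv⟩, hx1⟩ := hx
  obtain ⟨c, rfl⟩ : ∃ c : ℂ, x = phi i c := ⟨⟨u, v⟩, hxuv⟩
  rw [norm_phi hi] at hx1 ⊢
  set P : ℍ →L[ℝ] ℂ := (prP i).toContinuousLinearMap with hP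
  have hPe : ∀ q, P q = prP i q := fun q => rfl
  set G : ℂ → ℂ := fun z => prP i (f (phi i z)) with hGdef
  have hub : ∀ z : ℂ, ‖z‖ < 1 → phi i z ∈ unitBall := fun z hz => by
    simpa [unitBall, norm_phi hi] using hz
  have hs : ∀ r : ℝ, 0 ≤ r → r < 1 → Summable (fun n => ‖prP i (a n)‖ * r ^ n) := by
    intro r h0 h1
    refine (hf.1.1 r h0 h1).of_nonneg_of_le (fun n => by positivity) fun n => ?_
    gcongr
    exact norm_prP hi _
  have hG : ∀ z : ℂ, ‖z‖ < 1 → HasSum (fun n => z ^ n * prP i (a n)) (G z) := by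
    intro z hz
    have := (hf.1.2 _ (hub z hz)).mapL P
    simpa only [hPe, phi_pow hi, prP_phi hi] using this
  have hG' : HasSum (fun n : ℕ => ((n : ℂ) + 1) * (c ^ n * prP i (a (n + 1))))
      (prP i (f' (phi i c))) := by
    have := (hf.2 _ (hub c hx1)).mapL P
    simp only [map_smul, hPe, phi_pow hi, prP_phi hi] at this
    convert this using 2 with n
    simp
  have hps := ps_aux hs hG
  have hbdd : BddAbove {r : ℝ | ∃ y ∈ sliceDisc i, ‖y - phi i c‖ ≤ 1 - ‖c‖ ∧ r = ‖comp1 i f y‖} := by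
    obtain ⟨C, hC⟩ := (isCompact_closedBall (0 : ℍ) 1).exists_bound_of_continuousOn hcont
    refine ⟨C, ?_⟩
    rintro r ⟨y, hy, -, rfl⟩
    rw [comp1_eq hi, norm_phi hi]
    exact (norm_prP hi _).trans (hC y (by simpa using hy.2.le))
  have hball : ∀ z ∈ Metric.ball c (1 - ‖c‖), ‖z‖ < 1 := by
    intro z hz
    rw [mem_ball_iff_norm] at hz
    have := norm_add_le (z - c) c
    rw [sub_add_cancel] at this
    linarith
  have := disc_aux (g := G) (c := c) (R := 1 - ‖c‖) (by linarith)
    (fun z hz => (hps z (hball z hz)).1.differentiableWithinAt)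
    (M := sSup {r : ℝ | ∃ y ∈ sliceDisc i, ‖y - phi i c‖ ≤ 1 - ‖c‖ ∧ r = ‖comp1 i f y‖})
    (fun z hz => le_csSup hbdd ⟨phi i z, ⟨⟨z.re, z.im, rfl⟩, hub z (hball z hz)⟩, by
      rw [← phi_sub, norm_phi hi]; exact (mem_ball_iff_norm.mp hz).le, by
      rw [comp1_eq hi, norm_phi hi]⟩)
  rw [(hps c hx1).2 _ hG'] at this
  rw [comp1_eq hi, comp1_eq hi, norm_phi hi, norm_phi hi]
  exact this

lemma anti_inv {i j : ℍ} (hij : OrthogonalUnits i j) : i * j⁻¹ = - (j⁻¹ * i) := by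
  obtain ⟨hi, hj, h⟩ := hij
  obtain ⟨hi0, hi1⟩ := unit_sq hi
  obtain ⟨hj0, hj1⟩ := unit_sq hj
  have h' : i.imI * j.imI + i.imJ * j.imJ + i.imK * j.imK = 0 := by
    simpa [hi0, hj0] using h
  have hinv : j⁻¹ = star j := by
    have hn : Quaternion.normSq j = 1 := by
      rw [Quaternion.normSq_eq_norm_mul_self, hj.2, one_mul]
    rw [Quaternion.inv_def, hn]; simp
  rw [hinv]
  ext <;> simp [hi0, hj0]
  · linear_combination 2 * h'
  all_goals ring

lemma comp2_eq {i j : ℍ} (hij : OrthogonalUnits i j) (f : ℍ → ℍ) (q : ℍ) :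
    comp2 i j f q = comp1 i (fun p => f p * j⁻¹) q := by
  simp only [comp1, comp2]
  rw [smul_mul_assoc, add_mul, mul_assoc (i * f q), anti_inv hij]
  congr 1
  simp [mul_assoc, sub_eq_add_neg]

lemma pyth {i j : ℍ} (hij : OrthogonalUnits i j) (f : ℍ → ℍ) (q : ℍ) :
    ‖f q‖ ^ 2 = ‖comp1 i f q‖ ^ 2 + ‖comp2 i j f q‖ ^ 2 := by
  have h := parallelogram_law_with_norm ℝ (f q) (i * f q * i)
  have h2 : ‖i * f q * i‖ = ‖f q‖ := by simp [hij.1.2]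
  simp only [comp1, comp2, norm_mul, norm_smul, norm_inv, hij.2.1.2]
  rw [h2] at h
  norm_num
  linarith

theorem stmt11 (i j : ℍ) (hij : OrthogonalUnits i j) (f f' : ℍ → ℍ) (a : ℕ → ℍ)
    (hf : SliceDeriv f f' a) (hcont : ContinuousOn f (Metric.closedBall 0 1)) :
    ∀ x ∈ sliceDisc i,
      (1 / 4 : ℝ) * (1 - ‖x‖) ^ 2 * ‖f' x‖ ^ 2 + ‖f x‖ ^ 2 ≤
        (‖x‖ - 1) * (‖comp1 i f' x‖ * ‖comp1 i f x‖ + ‖comp2 i j f' x‖ * ‖comp2 i j f x‖) +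
        sSup {r : ℝ | ∃ y ∈ sliceDisc i, ‖y - x‖ ≤ 1 - ‖x‖ ∧ r = ‖comp1 i f y‖} ^ 2 +
        sSup {r : ℝ | ∃ y ∈ sliceDisc i, ‖y - x‖ ≤ 1 - ‖x‖ ∧ r = ‖comp2 i j f y‖} ^ 2 := by

  intro x hx
  have k1 := key hij.1 f f' a hf hcont x hx
  have hf2 : SliceDeriv (fun p => f p * j⁻¹) (fun p => f' p * j⁻¹) (fun n => a n * j⁻¹) := by
    have hj : ‖j⁻¹‖ = 1 := by rw [norm_inv, hij.2.1.2, inv_one]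
    refine ⟨⟨?_, ?_⟩, ?_⟩
    · intro r h0 h1
      simpa [norm_mul, hij.2.1.2] using hf.1.1 r h0 h1
    · intro q hq
      simpa only [mul_assoc] using (hf.1.2 q hq).mul_right j⁻¹
    · intro q hq
      simpa only [mul_assoc, smul_mul_assoc] using (hf.2 q hq).mul_right j⁻¹
  have k2 := key hij.1 _ _ _ hf2 (hcont.mul continuousOn_const) x hx
  simp only [← comp2_eq hij] at k2
  rw [pyth hij f x, pyth hij f' x]
  have hx1 : 0 ≤ 1 - ‖x‖ := sub_nonneg.mpr (le_of_lt hx.2)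
  have s1 := pow_le_pow_left₀ (by positivity) k1 2
  have s2 := pow_le_pow_left₀ (by positivity) k2 2
  linarith
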